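/- arXiv:2505.02065 — 3 statements merged into one kernel-verified Lean document; each statement's English description precedes it below -/
import Mathlib

section
/- There exists a constant C > 0, depending only on n, σ and Ω, such that for every infinitely differentiable function u : ℝ^n → ℝ with compact support contained in Ω one has ∫_{ℝ^n} |u(x)|² dx + 2 ∫_{ℝ^n} |∇u(x)|² dx + [u]² ≤ C [u]², where [u]² = ∫_{ℝ^n} ∫_{ℝ^n} |∇u(x) − ∇u(y)|² / |x−y|^{n+2σ} dx dy. (Since [u]² is one of the three summands on the left, this expresses the equivalence of the full H^s-norm on H_0^s with the Gagliardo seminorm of the gradient.) -/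
open MeasureTheory

/-- Radial majorant of the Gagliardo kernel. -/
noncomputable def kerMaj (a : ℝ) (r : ℝ) : ℝ := if r ≤ 1 then r ^ (2 - a) else r ^ (-a)

lemma kerMaj_nonneg (a : ℝ) {r : ℝ} (hr : 0 ≤ r) : 0 ≤ kerMaj a r := by
  unfold kerMaj
  split_ifs <;> positivity

lemma le_kerMaj (a : ℝ) {r d L M : ℝ} (hr : 0 ≤ r) (hd : 0 ≤ d) (h1 : d ≤ L * r) (h2 : d ≤ M) :
    d ^ 2 / r ^ a ≤ (L ^ 2 + M ^ 2) * kerMaj a r := by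
  rcases hr.eq_or_lt with rfl | hr'
  · have : d = 0 := by
      apply le_antisymm _ hd
      simpa using h1
    subst this
    have := kerMaj_nonneg a le_rfl
    simp only [ne_eq, OfNat.ofNat_ne_zero, not_false_eq_true, zero_pow, zero_div]
    positivity
  · have hM : 0 ≤ M := hd.trans h2
    have e1 : d ^ 2 ≤ L ^ 2 * r ^ 2 := by
      rw [← mul_pow]; gcongr
    have e2 : d ^ 2 ≤ M ^ 2 := by gcongr
    have hp : 0 < r ^ a := Real.rpow_pos_of_pos hr' a
    unfold kerMaj
    split_ifs with h
    · rw [Real.rpow_sub hr', Real.rpow_two, div_le_iff₀ hp]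
      have : (L ^ 2 + M ^ 2) * (r ^ 2 / r ^ a) * r ^ a = (L ^ 2 + M ^ 2) * r ^ 2 := by
        field_simp
      rw [this]
      nlinarith [sq_nonneg (M * r)]
    · rw [Real.rpow_neg hr, ← div_eq_mul_inv]
      gcongr
      nlinarith [sq_nonneg L]

lemma integrable_kerMaj {n : ℕ} (hn : 0 < n) (σ : ℝ) (hσ : σ ∈ Set.Ioo (0:ℝ) 1) :
    Integrable (fun x : EuclideanSpace ℝ (Fin n) => kerMaj ((n : ℝ) + 2 * σ) ‖x‖) := by
  haveI : Nonempty (Fin n) := ⟨⟨0, hn⟩⟩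
  haveI : Nontrivial (EuclideanSpace ℝ (Fin n)) := inferInstance
  rw [integrable_fun_norm_addHaar (volume : Measure (EuclideanSpace ℝ (Fin n)))
    (f := kerMaj ((n : ℝ) + 2 * σ))]
  simp only [finrank_euclideanSpace, Fintype.card_fin, smul_eq_mul]
  rw [← Set.Ioc_union_Ioi_eq_Ioi (zero_le_one' ℝ)]
  have hcast : ((n - 1 : ℕ) : ℝ) = n - 1 := by
    rw [Nat.cast_sub hn]; simp
  refine IntegrableOn.union ?_ ?_
  · have h : IntegrableOn (fun r : ℝ => r ^ (1 - 2 * σ)) (Set.Ioc 0 1) := by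
      rw [← intervalIntegrable_iff_integrableOn_Ioc_of_le zero_le_one]
      exact intervalIntegral.intervalIntegrable_rpow' (by linarith [hσ.2])
    refine h.congr_fun (fun r hr => ?_) measurableSet_Ioc
    simp only [kerMaj, if_pos hr.2]
    rw [← Real.rpow_natCast, ← Real.rpow_add hr.1, hcast]
    congr 1; ring
  · have h : IntegrableOn (fun r : ℝ => r ^ (-1 - 2 * σ)) (Set.Ioi 1) :=
      integrableOn_Ioi_rpow_of_lt (by linarith [hσ.1]) one_pos
    refine h.congr_fun (fun r hr => ?_) measurableSet_Ioi
    have hr' : (1:ℝ) < r := hr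
    simp only [kerMaj, if_neg (not_le.mpr hr')]
    rw [← Real.rpow_natCast, ← Real.rpow_add (by linarith), hcast]
    congr 1; ring

/-- The Gagliardo integrand of a compactly supported Lipschitz map is integrable on the product. -/
lemma integrable_gagliardo {n : ℕ} (hn : 0 < n) (σ : ℝ) (hσ : σ ∈ Set.Ioo (0:ℝ) 1)
    (g : EuclideanSpace ℝ (Fin n) → EuclideanSpace ℝ (Fin n)) (hg : HasCompactSupport g)
    {L : NNReal} (hL : LipschitzWith L g) :
    Integrable (fun p : EuclideanSpace ℝ (Fin n) × EuclideanSpace ℝ (Fin n) =>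
      ‖g p.1 - g p.2‖ ^ 2 / ‖p.1 - p.2‖ ^ ((n : ℝ) + 2 * σ)) (volume.prod volume) := by
  obtain ⟨M, hM⟩ := hg.exists_bound_of_continuous hL.continuous
  set a : ℝ := (n : ℝ) + 2 * σ
  set S := tsupport g
  have hSm : MeasurableSet S := (isClosed_tsupport g).measurableSet
  have hind : Integrable (S.indicator (fun _ => (1:ℝ))) (volume) := by
    rw [integrable_indicator_iff hSm]
    exact integrableOn_const hg.isCompact.measure_lt_top.ne
  have hk := integrable_kerMaj hn σ hσ
  have h1 := hind.convolution_integrand (ContinuousLinearMap.mul ℝ ℝ) hk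
  have h2 := h1.swap
  have h3 := (h1.add h2).const_mul ((L:ℝ) ^ 2 + (M + M) ^ 2)
  have hcont : Continuous g := hL.continuous
  refine h3.mono' ?_ (Filter.Eventually.of_forall ?_)
  · refine Measurable.aestronglyMeasurable ?_
    have := hcont.measurable
    fun_prop
  · rintro ⟨x, y⟩
    have hA : 0 ≤ ((L:ℝ) ^ 2 + (M + M) ^ 2) := by positivity
    have hkn : 0 ≤ kerMaj a ‖x - y‖ := kerMaj_nonneg a (norm_nonneg _)
    have hnn : 0 ≤ ‖g x - g y‖ ^ 2 / ‖x - y‖ ^ a := by positivity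
    rw [Real.norm_of_nonneg hnn]
    simp only [Pi.add_apply, Function.comp_apply, Prod.swap, Prod.fst_swap, Prod.snd_swap,
      ContinuousLinearMap.mul_apply', norm_sub_rev y x]
    have key : ‖g x - g y‖ ^ 2 / ‖x - y‖ ^ a ≤ ((L:ℝ) ^ 2 + (M + M) ^ 2) * kerMaj a ‖x - y‖ := by
      apply le_kerMaj a (norm_nonneg _) (norm_nonneg _)
      · exact hL.norm_sub_le x y
      · exact (norm_sub_le _ _).trans (add_le_add (hM x) (hM y))
    by_cases hx : x ∈ S <;> by_cases hy : y ∈ S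
    · simp only [hx, hy, Set.indicator_of_mem]
      nlinarith [mul_nonneg hA hkn]
    · simp only [hx, hy, Set.indicator_of_mem, Set.indicator_of_notMem, not_false_eq_true]
      nlinarith [mul_nonneg hA hkn]
    · simp only [hx, hy, Set.indicator_of_mem, Set.indicator_of_notMem, not_false_eq_true]
      nlinarith [mul_nonneg hA hkn]
    · simp [hx, hy, image_eq_zero_of_notMem_tsupport hx, image_eq_zero_of_notMem_tsupport hy]

lemma l2_le_gagliardo {n : ℕ} (hn : 0 < n) (σ : ℝ) (hσ : σ ∈ Set.Ioo (0:ℝ) 1) {R : ℝ}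
    (hR : 0 < R) : ∃ C > 0, ∀ g : EuclideanSpace ℝ (Fin n) → EuclideanSpace ℝ (Fin n),
      HasCompactSupport g → tsupport g ⊆ Metric.ball 0 R → (∃ L : NNReal, LipschitzWith L g) →
      (∫ x, ‖g x‖ ^ 2) ≤
        C * ∫ x, ∫ y, ‖g x - g y‖ ^ 2 / ‖x - y‖ ^ ((n : ℝ) + 2 * σ) := by
  haveI : Nonempty (Fin n) := ⟨⟨0, hn⟩⟩
  obtain ⟨p, hp⟩ : ∃ p : EuclideanSpace ℝ (Fin n), ‖p‖ = 3 * R :=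
    exists_norm_eq _ (by positivity)
  set a : ℝ := (n : ℝ) + 2 * σ
  have ha : 0 ≤ a := by have := hσ.1; positivity
  set V : ℝ := volume.real (Metric.ball p R)
  have hV : 0 < V := by
    apply ENNReal.toReal_pos
    · exact (Metric.measure_ball_pos volume p hR).ne'
    · exact measure_ball_lt_top.ne
  have hc : 0 < (5 * R) ^ a := by positivity
  refine ⟨(5 * R) ^ a / V, by positivity, ?_⟩
  rintro g hg hgR ⟨L, hL⟩
  have hint := integrable_gagliardo hn σ hσ g hg hL
  rw [← integral_const_mul]
  have hgc : Continuous (fun x => ‖g x‖ ^ 2) := (hL.continuous.norm.pow 2)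
  have hgi : Integrable (fun x => ‖g x‖ ^ 2) := by
    apply hgc.integrable_of_hasCompactSupport
    exact hg.comp_left (g := fun v => ‖v‖ ^ 2) (by simp)
  refine integral_mono_ae hgi (hint.integral_prod_left.const_mul _) ?_
  filter_upwards [hint.prod_right_ae] with x hx
  by_cases hxS : x ∈ tsupport g
  · have hxR : ‖x‖ < R := by simpa using hgR hxS
    have hlow : ∫ y in Metric.ball p R, ‖g x‖ ^ 2 / (5 * R) ^ a ≤
        ∫ y, ‖g x - g y‖ ^ 2 / ‖x - y‖ ^ a := by
      calc _ ≤ ∫ y in Metric.ball p R, ‖g x - g y‖ ^ 2 / ‖x - y‖ ^ a := by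
            refine setIntegral_mono_on (integrableOn_const measure_ball_lt_top.ne)
              hx.integrableOn measurableSet_ball ?_
            intro y hy
            have hyp : ‖y - p‖ < R := by simpa [dist_eq_norm] using hy
            have t1 : ‖p‖ ≤ ‖y‖ + ‖y - p‖ := by
              have := norm_sub_le y (y - p); simpa using this
            have t2 : ‖y‖ ≤ ‖y - p‖ + ‖p‖ := by
              have := norm_add_le (y - p) p; simpa using this
            have t3 : ‖y‖ ≤ ‖x‖ + ‖x - y‖ := by
              have := norm_sub_le x (x - y); simpa using this
            have t4 := norm_sub_le x y
            have hgy : g y = 0 := by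
              apply image_eq_zero_of_notMem_tsupport
              intro h
              have : ‖y‖ < R := by simpa using hgR h
              linarith
            have hpos : 0 < ‖x - y‖ := by linarith
            rw [hgy, sub_zero]
            gcongr
            linarith
        _ ≤ _ := setIntegral_le_integral hx (Filter.Eventually.of_forall fun y => by
            simp only [Pi.zero_apply]; positivity)
    rw [setIntegral_const, smul_eq_mul] at hlow
    calc ‖g x‖ ^ 2 = (5 * R) ^ a / V * (V * (‖g x‖ ^ 2 / (5 * R) ^ a)) := by
          field_simp
      _ ≤ _ := by gcongr
  · rw [image_eq_zero_of_notMem_tsupport hxS]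
    have : 0 ≤ ∫ y, ‖(0 : EuclideanSpace ℝ (Fin n)) - g y‖ ^ 2 / ‖x - y‖ ^ a :=
      integral_nonneg fun y => by positivity
    simp only [norm_zero, ne_eq, OfNat.ofNat_ne_zero, not_false_eq_true, zero_pow]
    exact mul_nonneg (div_pos hc hV).le this

lemma toReal_eLpNorm_two_sq {α E : Type*} [MeasurableSpace α] [NormedAddCommGroup E]
    {μ : Measure α} {f : α → E} (hf : MemLp f 2 μ) :
    (eLpNorm f 2 μ).toReal ^ 2 = ∫ x, ‖f x‖ ^ 2 ∂μ := by
  rw [hf.eLpNorm_eq_integral_rpow_norm two_ne_zero ENNReal.ofNat_ne_top]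
  have h0 : 0 ≤ ∫ x, ‖f x‖ ^ 2 ∂μ := integral_nonneg fun x => by positivity
  simp only [ENNReal.toReal_ofNat, Real.rpow_two]
  rw [ENNReal.toReal_ofReal (by positivity), ← Real.rpow_two, ← Real.rpow_mul h0]
  simp

lemma poincare {n : ℕ} (hn : 2 < n) (Ω : Set (EuclideanSpace ℝ (Fin n)))
    (hΩ : Bornology.IsBounded Ω) : ∃ C ≥ 0, ∀ u : EuclideanSpace ℝ (Fin n) → ℝ,
      ContDiff ℝ 1 u → HasCompactSupport u → tsupport u ⊆ Ω →
      (∫ x, (u x) ^ 2) ≤ C * ∫ x, ‖fderiv ℝ u x‖ ^ 2 := by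
  set K := eLpNormLESNormFDerivOfLeConst ℝ (volume : Measure (EuclideanSpace ℝ (Fin n))) Ω 2 2
  refine ⟨(K : ℝ) ^ 2, by positivity, ?_⟩
  intro u hu hcu hsu
  have h := eLpNorm_le_eLpNorm_fderiv_of_le (volume : Measure (EuclideanSpace ℝ (Fin n)))
    (p := 2) (q := 2) hu ((subset_tsupport u).trans hsu) (by norm_num)
    (by simp only [finrank_euclideanSpace, Fintype.card_fin]; exact_mod_cast hn)
    (by simp) hΩ
  have m1 : MemLp u 2 (volume : Measure (EuclideanSpace ℝ (Fin n))) :=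
    hu.continuous.memLp_of_hasCompactSupport hcu
  have m2 : MemLp (fderiv ℝ u) 2 (volume : Measure (EuclideanSpace ℝ (Fin n))) :=
    (hu.continuous_fderiv one_ne_zero).memLp_of_hasCompactSupport (hcu.fderiv ℝ)
  have e1 := toReal_eLpNorm_two_sq m1
  have e2 := toReal_eLpNorm_two_sq m2
  simp only [Real.norm_eq_abs, sq_abs] at e1
  rw [← e1, ← e2, ← mul_pow]
  gcongr
  have h' := ENNReal.toReal_mono (ENNReal.mul_ne_top ENNReal.coe_ne_top m2.eLpNorm_lt_top.ne) h
  simpa [ENNReal.toReal_mul] using h'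

/-- equivalence of the full `H^s`-norm with the Gagliardo seminorm of
the gradient on smooth compactly supported functions in `Ω`:
`∫|u|² + 2∫|∇u|² + [u]² ≤ C [u]²`. -/
theorem stmt_2 {n : ℕ} (hn : 0 < n) (σ : ℝ) (hσ : σ ∈ Set.Ioo (0:ℝ) 1)
    (hns : 2 * (1 + σ) < n) (Ω : Set (EuclideanSpace ℝ (Fin n)))
    (hΩne : Ω.Nonempty) (hΩopen : IsOpen Ω) (hΩbdd : Bornology.IsBounded Ω) :
    ∃ C > 0, ∀ u : EuclideanSpace ℝ (Fin n) → ℝ,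
      ContDiff ℝ (⊤ : ℕ∞) u → HasCompactSupport u → tsupport u ⊆ Ω →
      (∫ x, (u x) ^ 2) + 2 * (∫ x, ‖gradient u x‖ ^ 2) +
          (∫ x, ∫ y, ‖gradient u x - gradient u y‖ ^ 2 / ‖x - y‖ ^ ((n : ℝ) + 2 * σ)) ≤
        C * ∫ x, ∫ y, ‖gradient u x - gradient u y‖ ^ 2 / ‖x - y‖ ^ ((n : ℝ) + 2 * σ) := by
  have hn2 : 2 < n := by
    have : (2:ℝ) < n := by linarith [hσ.1]
    exact_mod_cast this
  obtain ⟨R, hR, hΩR⟩ := hΩbdd.subset_ball_lt 0 0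
  obtain ⟨C₁, hC₁, h1⟩ := poincare hn2 Ω hΩbdd
  obtain ⟨C₂, hC₂, h2⟩ := l2_le_gagliardo hn σ hσ hR
  refine ⟨(C₁ + 2) * C₂ + 1, by positivity, ?_⟩
  intro u hu hcu hsu
  have hgeq : gradient u = fun x =>
      (InnerProductSpace.toDual ℝ (EuclideanSpace ℝ (Fin n))).symm (fderiv ℝ u x) := rfl
  have hnorm : ∀ x, ‖gradient u x‖ = ‖fderiv ℝ u x‖ := fun x => by
    rw [hgeq]; simp
  have hsupp : Function.support (gradient u) = Function.support (fderiv ℝ u) := by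
    ext x
    rw [Function.mem_support, Function.mem_support, ← norm_ne_zero_iff, hnorm,
      norm_ne_zero_iff]
  have hts : tsupport (gradient u) = tsupport (fderiv ℝ u) := by
    unfold tsupport; rw [hsupp]
  have hgcs : HasCompactSupport (gradient u) := by
    unfold HasCompactSupport; rw [hts]; exact hcu.fderiv ℝ
  have hgs : tsupport (gradient u) ⊆ Metric.ball 0 R := by
    rw [hts]; exact (tsupport_fderiv_subset ℝ).trans (hsu.trans hΩR)
  have hgd : ContDiff ℝ 1 (gradient u) := by
    rw [hgeq]
    have hf : ContDiff ℝ 1 (fderiv ℝ u) := hu.fderiv_right (m := 1) (by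
      rw [one_add_one_eq_two]; exact WithTop.coe_le_coe.2 (le_top : (2 : ℕ∞) ≤ ⊤))
    exact (InnerProductSpace.toDual ℝ
      (EuclideanSpace ℝ (Fin n))).symm.toContinuousLinearEquiv.contDiff.comp hf
  have i1 := h1 u (hu.of_le (by exact_mod_cast le_top)) hcu hsu
  have i2 := h2 (gradient u) hgcs hgs
    (ContDiff.lipschitzWith_of_hasCompactSupport hgcs hgd one_ne_zero)
  simp only [← hnorm] at i1
  have i3 := mul_le_mul_of_nonneg_left i2 (by positivity : 0 ≤ C₁ + 2)
  linarith
end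

section
/- Let f : ℝ^n × ℝ → ℝ be continuous and satisfy (H3): for every M > 0 there exists T > 0 such that F(x,t) ≥ M t² for all x ∈ Ω and all |t| ≥ T, where F(x,t) = ∫₀ᵗ f(x,τ) dτ. Then for every infinitely differentiable φ : ℝ^n → ℝ with compact support contained in Ω and φ not identically zero, the energy J(tφ) = (1/2)t²[φ]² − ∫_Ω F(x, tφ(x)) dx tends to −∞ as t → +∞. In particular, for any ρ > 0 and β ∈ ℝ there exists such an e with [e] > ρ and J(e) < β. -/
open MeasureTheory Filter

theorem aux_kernel {n : ℕ} (hn : 0 < n) (σ : ℝ) (hσ : σ ∈ Set.Ioo (0:ℝ) 1) :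
    Integrable (fun z : EuclideanSpace ℝ (Fin n) =>
      min 1 (‖z‖ ^ 2) / ‖z‖ ^ ((n : ℝ) + 2 * σ)) := by
  have : Nonempty (Fin n) := ⟨⟨0, hn⟩⟩
  obtain ⟨h0, h1⟩ := hσ
  have key := (integrable_fun_norm_addHaar (F := ℝ)
    (volume : Measure (EuclideanSpace ℝ (Fin n)))
    (f := fun r : ℝ => min 1 (r ^ 2) / r ^ ((n : ℝ) + 2 * σ))).2
  apply key
  rw [finrank_euclideanSpace_fin]
  have e : ∀ y : ℝ, 0 < y → y ^ (n - 1) = y ^ ((n : ℝ) - 1) := by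
    intro y hy
    rw [← Real.rpow_natCast, Nat.cast_sub hn, Nat.cast_one]
  have hsplit : Set.Ioi (0:ℝ) = Set.Ioo 0 1 ∪ Set.Ici 1 := by
    rw [Set.Ioo_union_Ici_eq_Ioi one_pos]
  rw [hsplit]
  apply IntegrableOn.union
  · have := (intervalIntegral.integrableOn_Ioo_rpow_iff (s := 1 - 2 * σ) one_pos).2 (by linarith)
    refine this.congr_fun ?_ measurableSet_Ioo
    intro y hy
    have hy2 : min 1 (y ^ 2) = y ^ (2:ℝ) := by
      rw [Real.rpow_two]; apply min_eq_right; nlinarith [hy.1, hy.2]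
    simp only [smul_eq_mul, hy2, e y hy.1]
    rw [← Real.rpow_sub hy.1, ← Real.rpow_add hy.1]
    congr 1; ring
  · rw [integrableOn_Ici_iff_integrableOn_Ioi]
    have := integrableOn_Ioi_rpow_of_lt (a := -1 - 2 * σ) (by linarith) one_pos
    refine this.congr_fun ?_ measurableSet_Ioi
    intro y hy
    have hy' : (1:ℝ) < y := hy
    have hy0 : 0 < y := by linarith
    have hy2 : min 1 (y ^ 2) = y ^ (0:ℝ) := by
      rw [Real.rpow_zero]; apply min_eq_left; nlinarith
    simp only [smul_eq_mul, hy2, e y hy0]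
    rw [← Real.rpow_sub hy0, ← Real.rpow_add hy0]
    congr 1; ring

theorem aux_integrable {n : ℕ} (hn : 0 < n) (σ : ℝ) (hσ : σ ∈ Set.Ioo (0:ℝ) 1)
    (G : EuclideanSpace ℝ (Fin n) → EuclideanSpace ℝ (Fin n)) (hG : Continuous G)
    (hc : HasCompactSupport G) (L : NNReal) (hL : LipschitzWith L G) :
    Integrable (fun p : EuclideanSpace ℝ (Fin n) × EuclideanSpace ℝ (Fin n) =>
      ‖G p.1 - G p.2‖ ^ 2 / ‖p.1 - p.2‖ ^ ((n : ℝ) + 2 * σ)) (volume.prod volume) := by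
  obtain ⟨B, hB⟩ := hc.exists_bound_of_continuous hG
  set k : EuclideanSpace ℝ (Fin n) → ℝ :=
    fun z => min 1 (‖z‖ ^ 2) / ‖z‖ ^ ((n : ℝ) + 2 * σ) with hk
  have hki : Integrable k := aux_kernel hn σ hσ
  set χ : EuclideanSpace ℝ (Fin n) → ℝ := (tsupport G).indicator (fun _ => 1) with hχ
  have hχi : Integrable χ := by
    rw [hχ, integrable_indicator_iff (isClosed_tsupport G).measurableSet]
    exact integrableOn_const (IsCompact.measure_lt_top hc).ne
  have h1 : Integrable (fun p : EuclideanSpace ℝ (Fin n) × EuclideanSpace ℝ (Fin n) =>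
      χ p.2 * k (p.1 - p.2)) (volume.prod volume) :=
    hχi.convolution_integrand (ContinuousLinearMap.mul ℝ ℝ) hki
  have h2 : Integrable (fun p : EuclideanSpace ℝ (Fin n) × EuclideanSpace ℝ (Fin n) =>
      χ p.1 * k (p.2 - p.1)) (volume.prod volume) := h1.swap
  have h3 := (h1.add h2).const_mul ((2 * B) ^ 2 + (L : ℝ) ^ 2)
  refine h3.mono' ?_ ?_
  · apply Measurable.aestronglyMeasurable
    have := hG.measurable
    fun_prop
  · refine Filter.Eventually.of_forall ?_
    rintro ⟨x, y⟩
    have hb0 : 0 ≤ B := (norm_nonneg _).trans (hB x)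
    have hksymm : k (y - x) = k (x - y) := by simp only [hk, norm_sub_rev]
    simp only [Pi.add_apply, hksymm]
    have hk0 : ∀ z, 0 ≤ k z := fun z => by simp only [hk]; positivity
    have hχ0 : ∀ z, 0 ≤ χ z := fun z => by
      simp only [hχ]; exact Set.indicator_nonneg (fun _ _ => zero_le_one) z
    rw [Real.norm_of_nonneg (by positivity)]
    by_cases hz : G x = 0 ∧ G y = 0
    · rw [hz.1, hz.2]
      simp only [sub_zero, norm_zero, ne_eq, OfNat.ofNat_ne_zero, not_false_eq_true, zero_pow,
        zero_div]
      have := hk0 (x - y); have := hχ0 x; have := hχ0 y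
      positivity
    · have hsum : 1 ≤ χ y + χ x := by
        by_cases hx : G x = 0
        · have hy : G y ≠ 0 := fun h => hz ⟨hx, h⟩
          have : χ y = 1 := Set.indicator_of_mem (subset_tsupport G hy) _
          linarith [hχ0 x]
        · have : χ x = 1 := Set.indicator_of_mem (subset_tsupport G hx) _
          linarith [hχ0 y]
      have hbd : ‖G x - G y‖ ^ 2 ≤ ((2 * B) ^ 2 + (L : ℝ) ^ 2) * min 1 (‖x - y‖ ^ 2) := by
        have a1 : ‖G x - G y‖ ≤ 2 * B := (norm_sub_le _ _).trans (by linarith [hB x, hB y])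
        have a2 : ‖G x - G y‖ ≤ L * ‖x - y‖ := hL.norm_sub_le x y
        have b1 : ‖G x - G y‖ ^ 2 ≤ (2 * B) ^ 2 := by gcongr
        have b2 : ‖G x - G y‖ ^ 2 ≤ (L * ‖x - y‖) ^ 2 := by gcongr
        rcases min_cases 1 (‖x - y‖ ^ 2) with ⟨h, _⟩ | ⟨h, _⟩ <;> rw [h]
        · nlinarith [sq_nonneg (L : ℝ)]
        · nlinarith [mul_nonneg (sq_nonneg (2 * B)) (sq_nonneg ‖x - y‖)]
      calc ‖G x - G y‖ ^ 2 / ‖x - y‖ ^ ((n : ℝ) + 2 * σ)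
          ≤ ((2 * B) ^ 2 + (L : ℝ) ^ 2) * min 1 (‖x - y‖ ^ 2) / ‖x - y‖ ^ ((n : ℝ) + 2 * σ) := by
            gcongr
        _ = ((2 * B) ^ 2 + (L : ℝ) ^ 2) * (1 * k (x - y)) := by simp only [hk]; ring
        _ ≤ ((2 * B) ^ 2 + (L : ℝ) ^ 2) * ((χ y + χ x) * k (x - y)) := by
            have := hk0 (x - y)
            gcongr
        _ = _ := by ring

theorem aux_pos {n : ℕ} (hn : 0 < n) (σ : ℝ) (hσ : σ ∈ Set.Ioo (0:ℝ) 1)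
    (φ : EuclideanSpace ℝ (Fin n) → ℝ)
    (hφ : ContDiff ℝ (⊤ : ℕ∞) φ) (hc : HasCompactSupport φ) (hne : φ ≠ 0) :
    0 < ∫ x, ∫ y, ‖gradient φ x - gradient φ y‖ ^ 2 / ‖x - y‖ ^ ((n : ℝ) + 2 * σ) := by
  have : Nonempty (Fin n) := ⟨⟨0, hn⟩⟩
  have hGc : HasCompactSupport (gradient φ) :=
    (hc.fderiv ℝ).comp_left (g := (InnerProductSpace.toDual ℝ _).symm) (map_zero _)
  have hGd : ContDiff ℝ 1 (gradient φ) := by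
    have : ContDiff ℝ 1 (fderiv ℝ φ) := hφ.fderiv_right (by norm_cast)
    exact (InnerProductSpace.toDual ℝ (EuclideanSpace ℝ (Fin n))).symm.contDiff.comp this
  obtain ⟨L, hL⟩ := ContDiff.lipschitzWith_of_hasCompactSupport hGc hGd one_ne_zero
  have hG := hGd.continuous
  have hI := aux_integrable hn σ hσ (gradient φ) hG hGc L hL
  rw [integral_integral hI]
  have hnn : 0 ≤ fun p : EuclideanSpace ℝ (Fin n) × EuclideanSpace ℝ (Fin n) =>
      ‖gradient φ p.1 - gradient φ p.2‖ ^ 2 / ‖p.1 - p.2‖ ^ ((n : ℝ) + 2 * σ) :=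
    fun p => by simp only [Pi.zero_apply]; positivity
  refine lt_of_le_of_ne (integral_nonneg hnn) (fun h => hne ?_)
  have h0 := (integral_eq_zero_iff_of_nonneg hnn hI).1 h.symm
  have h1 : (fun p : EuclideanSpace ℝ (Fin n) × EuclideanSpace ℝ (Fin n) => gradient φ p.1)
      =ᵐ[volume.prod volume] fun p => gradient φ p.2 := by
    filter_upwards [h0] with p hp
    simp only [Pi.zero_apply, div_eq_zero_iff] at hp
    rcases hp with hp | hp
    · exact sub_eq_zero.1 (norm_eq_zero.1 (pow_eq_zero_iff two_ne_zero |>.1 hp))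
    · have := (Real.rpow_eq_zero_iff_of_nonneg (norm_nonneg _)).1 hp
      rw [sub_eq_zero.1 (norm_eq_zero.1 this.1)]
  have h2 := (Continuous.ae_eq_iff_eq (volume.prod volume) (hG.comp continuous_fst)
    (hG.comp continuous_snd)).1 h1
  have h3 : ∀ x y, gradient φ x = gradient φ y := fun x y => congrFun h2 (x, y)
  have h4 : ∀ x, gradient φ x = 0 := by
    obtain ⟨z, hz⟩ := (Set.ne_univ_iff_exists_notMem _).1 hGc.isCompact.ne_univ
    intro x
    rw [h3 x z, image_eq_zero_of_notMem_tsupport hz]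
  have h5 : ∀ x, fderiv ℝ φ x = 0 := by
    intro x
    rw [← toDual_gradient, h4 x, map_zero]
  have h6 := is_const_of_fderiv_eq_zero (hφ.differentiable (by simp)) h5
  obtain ⟨z, hz⟩ := (Set.ne_univ_iff_exists_notMem _).1 hc.isCompact.ne_univ
  funext x
  rw [h6 x z, image_eq_zero_of_notMem_tsupport hz, Pi.zero_apply]

theorem aux_smul {n : ℕ} (p : ℝ)
    (φ : EuclideanSpace ℝ (Fin n) → ℝ) (hφ : ContDiff ℝ (⊤ : ℕ∞) φ) (t : ℝ) :
    (∫ x, ∫ y, ‖gradient (fun z => t * φ z) x - gradient (fun z => t * φ z) y‖ ^ 2 /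
      ‖x - y‖ ^ p) = t ^ 2 * ∫ x, ∫ y, ‖gradient φ x - gradient φ y‖ ^ 2 / ‖x - y‖ ^ p := by
  have hg : ∀ x, gradient (fun z => t * φ z) x = t • gradient φ x := by
    intro x
    unfold gradient
    rw [fderiv_const_mul (hφ.differentiable (by simp) x), map_smulₛₗ]
    simp
  rw [← integral_const_mul]
  congr 1; funext x
  rw [← integral_const_mul]
  congr 1; funext y
  rw [hg, hg, ← smul_sub, norm_smul, mul_pow, Real.norm_eq_abs, sq_abs, mul_div_assoc]

theorem aux_tendsto {n : ℕ} (Ω : Set (EuclideanSpace ℝ (Fin n)))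
    (hΩopen : IsOpen Ω) (hΩbdd : Bornology.IsBounded Ω)
    (f : EuclideanSpace ℝ (Fin n) → ℝ → ℝ)
    (hf : Continuous fun p : EuclideanSpace ℝ (Fin n) × ℝ => f p.1 p.2)
    (H3 : ∀ M > 0, ∃ T > 0, ∀ x ∈ Ω, ∀ t : ℝ, T ≤ |t| →
      M * t ^ 2 ≤ ∫ τ in (0:ℝ)..t, f x τ)
    (φ : EuclideanSpace ℝ (Fin n) → ℝ) (hφ : Continuous φ)
    (hs : tsupport φ ⊆ Ω) (hne : φ ≠ 0) (S : ℝ) :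
    Tendsto (fun t : ℝ => (1 / 2) * t ^ 2 * S -
            ∫ x in Ω, (∫ τ in (0:ℝ)..(t * φ x), f x τ)) atTop atBot := by
  have hF : Continuous fun p : EuclideanSpace ℝ (Fin n) × ℝ => ∫ τ in (0:ℝ)..p.2, f p.1 τ :=
    intervalIntegral.continuous_parametric_intervalIntegral_of_continuous
      (f := fun (p : EuclideanSpace ℝ (Fin n) × ℝ) τ => f p.1 τ)
      (by
        have : Continuous fun q : (EuclideanSpace ℝ (Fin n) × ℝ) × ℝ => f q.1.1 q.2 :=
          hf.comp (f := fun q : (EuclideanSpace ℝ (Fin n) × ℝ) × ℝ => (q.1.1, q.2)) (by fun_prop)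
        exact this) continuous_snd
  have hK : IsCompact (closure Ω) := hΩbdd.isCompact_closure
  have hfin : volume Ω ≠ ⊤ := hΩbdd.measure_lt_top.ne
  have hint : ∀ g : EuclideanSpace ℝ (Fin n) → ℝ, Continuous g → IntegrableOn g Ω :=
    fun g hg => (hg.continuousOn.integrableOn_compact hK).mono_set subset_closure
  set A := ∫ x in Ω, φ x ^ 2 with hA
  have hApos : 0 < A := by
    obtain ⟨x, hx⟩ := Function.ne_iff.1 hne
    have hx' : φ x ≠ 0 := hx
    rw [hA, setIntegral_eq_integral_of_forall_compl_eq_zero]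
    · refine Continuous.integral_pos_of_hasCompactSupport_nonneg_nonzero (x := x) (by fun_prop)
        ?_ (fun y => sq_nonneg _) (pow_ne_zero 2 hx')
      refine HasCompactSupport.of_support_subset_isCompact hK ?_
      intro y hy
      refine subset_closure (hs (subset_tsupport _ ?_))
      intro h
      apply hy
      simp [h]
    · intro y hy
      have := image_eq_zero_of_notMem_tsupport (fun h => hy (hs h))
      simp [this]
  set M := (|S| + 1) / A with hM
  have hMpos : 0 < M := by positivity
  obtain ⟨T, hT, hTF⟩ := H3 M hMpos
  obtain ⟨C, hC⟩ := (hK.prod (isCompact_Icc (a := -T) (b := T))).exists_bound_of_continuousOn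
    hF.continuousOn
  have hlow : ∀ x ∈ Ω, ∀ t : ℝ, M * t ^ 2 - (|C| + M * T ^ 2) ≤ ∫ τ in (0:ℝ)..t, f x τ := by
    intro x hx t
    by_cases ht : T ≤ |t|
    · have := hTF x hx t ht
      have : 0 ≤ |C| + M * T ^ 2 := by positivity
      linarith
    · push Not at ht
      have h1 := hC (x, t) ⟨subset_closure hx, abs_le.1 ht.le⟩
      rw [Real.norm_eq_abs] at h1
      have h2 := (abs_le.1 h1).1
      have h3 : M * t ^ 2 ≤ M * T ^ 2 := by
        have : t ^ 2 ≤ T ^ 2 := sq_le_sq' (abs_le.1 ht.le).1 (abs_le.1 ht.le).2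
        gcongr
      have := le_abs_self C
      simp only at h2
      linarith
  set D := (|C| + M * T ^ 2) * volume.real Ω with hD
  have hmain : ∀ t : ℝ, (1 / 2) * t ^ 2 * S -
            ∫ x in Ω, (∫ τ in (0:ℝ)..(t * φ x), f x τ) ≤ D - t ^ 2 := by
    intro t
    have h1 : ∫ x in Ω, (M * (t * φ x) ^ 2 - (|C| + M * T ^ 2)) ≤
        ∫ x in Ω, (∫ τ in (0:ℝ)..(t * φ x), f x τ) := by
      refine setIntegral_mono_on (hint _ (by fun_prop)) (hint _ ?_) hΩopen.measurableSet
        (fun x hx => hlow x hx _)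
      exact hF.comp (f := fun x => (x, t * φ x)) (by fun_prop)
    have h2 : ∫ x in Ω, (M * (t * φ x) ^ 2 - (|C| + M * T ^ 2)) = t ^ 2 * (M * A) - D := by
      rw [integral_sub (hint _ (by fun_prop)) (hint _ (by fun_prop))]
      simp only [setIntegral_const, smul_eq_mul, mul_pow, integral_const_mul, hD, hA]
      ring
    have h3 : M * A = |S| + 1 := by rw [hM]; field_simp
    rw [h2, h3] at h1
    have h4 := le_abs_self S
    have h5 := abs_nonneg S
    nlinarith [mul_nonneg (sq_nonneg t) h5, mul_nonneg (sq_nonneg t) (sub_nonneg.2 h4)]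
  refine tendsto_atBot_mono hmain ?_
  exact tendsto_atBot_add_const_left _ D
    (tendsto_neg_atTop_atBot.comp (tendsto_pow_atTop two_ne_zero))

/-- under (H3) the energy along rays tends to `−∞`: for every smooth
nonzero `φ` with compact support in `Ω`, `J(tφ) → −∞` as `t → +∞`; in particular,
for every `ρ > 0` and `β ∈ ℝ` there is such an `e` with `[e] > ρ` and `J(e) < β`. -/
theorem stmt_6 {n : ℕ} (hn : 0 < n) (σ : ℝ) (hσ : σ ∈ Set.Ioo (0:ℝ) 1)
    (hns : 2 * (1 + σ) < n) (Ω : Set (EuclideanSpace ℝ (Fin n)))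
    (hΩne : Ω.Nonempty) (hΩopen : IsOpen Ω) (hΩbdd : Bornology.IsBounded Ω)
    (f : EuclideanSpace ℝ (Fin n) → ℝ → ℝ)
    (hf : Continuous fun p : EuclideanSpace ℝ (Fin n) × ℝ => f p.1 p.2)
    (H3 : ∀ M > 0, ∃ T > 0, ∀ x ∈ Ω, ∀ t : ℝ, T ≤ |t| →
      M * t ^ 2 ≤ ∫ τ in (0:ℝ)..t, f x τ) :
    (∀ φ : EuclideanSpace ℝ (Fin n) → ℝ,
      ContDiff ℝ (⊤ : ℕ∞) φ → HasCompactSupport φ → tsupport φ ⊆ Ω → φ ≠ 0 →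
      Tendsto (fun t : ℝ =>
          (1 / 2) * t ^ 2 *
              (∫ x, ∫ y, ‖gradient φ x - gradient φ y‖ ^ 2 / ‖x - y‖ ^ ((n : ℝ) + 2 * σ)) -
            ∫ x in Ω, (∫ τ in (0:ℝ)..(t * φ x), f x τ))
        atTop atBot) ∧
    (∀ ρ > 0, ∀ β : ℝ, ∃ e : EuclideanSpace ℝ (Fin n) → ℝ,
      ContDiff ℝ (⊤ : ℕ∞) e ∧ HasCompactSupport e ∧ tsupport e ⊆ Ω ∧
      ρ < Real.sqrt (∫ x, ∫ y, ‖gradient e x - gradient e y‖ ^ 2 / ‖x - y‖ ^ ((n : ℝ) + 2 * σ)) ∧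
      (1 / 2) * (∫ x, ∫ y, ‖gradient e x - gradient e y‖ ^ 2 / ‖x - y‖ ^ ((n : ℝ) + 2 * σ)) -
          (∫ x in Ω, (∫ τ in (0:ℝ)..(e x), f x τ)) < β) := by
  refine ⟨fun φ hφ _ hs hne => aux_tendsto Ω hΩopen hΩbdd f hf H3 φ hφ.continuous hs hne _, ?_⟩
  intro ρ _ β
  obtain ⟨x, hx⟩ := hΩne
  obtain ⟨φ, hs, hc, hφ, _, hφx⟩ :=
    exists_contDiff_tsupport_subset (n := (⊤ : ℕ∞)) (hΩopen.mem_nhds hx)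
  have hne : φ ≠ 0 := fun h => by simp [h] at hφx
  have hpos := aux_pos hn σ hσ φ hφ hc hne
  have hlim := aux_tendsto Ω hΩopen hΩbdd f hf H3 φ hφ.continuous hs hne
    (∫ x, ∫ y, ‖gradient φ x - gradient φ y‖ ^ 2 / ‖x - y‖ ^ ((n : ℝ) + 2 * σ))
  set S := ∫ x, ∫ y, ‖gradient φ x - gradient φ y‖ ^ 2 / ‖x - y‖ ^ ((n : ℝ) + 2 * σ) with hS
  have hsq : 0 < Real.sqrt S := Real.sqrt_pos.2 hpos
  have hlim2 : Tendsto (fun t : ℝ => t * Real.sqrt S) atTop atTop :=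
    tendsto_id.atTop_mul_const hsq
  obtain ⟨t, ht1, ht2, ht3⟩ := ((hlim.eventually_lt_atBot β).and
    ((hlim2.eventually_gt_atTop ρ).and (eventually_ge_atTop 0))).exists
  have hsub : tsupport (fun z => t * φ z) ⊆ tsupport φ := by
    apply closure_mono
    intro z hz h
    apply hz
    simp [h]
  refine ⟨fun z => t * φ z, contDiff_const.mul hφ, hc.mono' ((subset_tsupport _).trans hsub),
    hsub.trans hs, ?_, ?_⟩
  · rw [aux_smul _ φ hφ t, ← hS, Real.sqrt_mul (sq_nonneg t), Real.sqrt_sq ht3]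
    exact ht2
  · rw [aux_smul _ φ hφ t, ← hS, ← mul_assoc]
    exact ht1
end

section
/- Let 1 < p < 2 and let g : ℝ^n × ℝ → ℝ be continuous such that there exist a₁, a₂ > 0 and q ∈ (2, 2n/(n−2s)) with |g(x,t)| ≤ a₁ + a₂|t|^{q-1} for all x ∈ Ω and t ∈ ℝ (H1), and such that for every ε > 0 there exists δ₀ > 0 with |g(x,t)| ≤ ε|t| whenever x ∈ Ω and |t| ≤ δ₀ (H2). For λ ∈ ℝ define J_λ(u) = (1/2)[u]² − (λ/p) ∫_Ω |u(x)|^p dx − ∫_Ω G(x, u(x)) dx, where G(x,t) = ∫₀ᵗ g(x,τ) dτ. Then there exists λ* > 0 such that for every λ ∈ (0, λ*) there exist ρ > 0 and R > 0 with J_λ(u) ≥ R for every infinitely differentiable u : ℝ^n → ℝ with compact support contained in Ω and [u] = ρ. -/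
open MeasureTheory

/-- local integrability of the Gagliardo kernel -/
lemma frac_inner_integrable {n : ℕ} (hn : 0 < n) (σ : ℝ) (hσ : σ ∈ Set.Ioo (0:ℝ) 1)
    (v : EuclideanSpace ℝ (Fin n) → EuclideanSpace ℝ (Fin n)) (hv : Continuous v)
    (L B : ℝ) (hL : ∀ x y, ‖v x - v y‖ ≤ L * ‖x - y‖) (hB : ∀ x, ‖v x‖ ≤ B)
    (x : EuclideanSpace ℝ (Fin n)) :
    Integrable (fun y => ‖v x - v y‖ ^ 2 / ‖x - y‖ ^ ((n : ℝ) + 2 * σ)) := by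
  obtain ⟨h0, h1⟩ := hσ
  have : Nontrivial (EuclideanSpace ℝ (Fin n)) := by
    have : Nonempty (Fin n) := ⟨⟨0, hn⟩⟩
    infer_instance
  set h : ℝ → ℝ := fun t => if t ≤ 1 then L ^ 2 * (t ^ 2 / t ^ ((n : ℝ) + 2 * σ))
    else (2 * B) ^ 2 / t ^ ((n : ℝ) + 2 * σ) with hh
  have hpow : ∀ t : ℝ, 0 < t → t ^ (n - 1) * t = t ^ (n : ℝ) := by
    intro t ht
    rw [← pow_succ, Nat.sub_add_cancel hn, Real.rpow_natCast]
  have key : Integrable (fun z : EuclideanSpace ℝ (Fin n) => h ‖z‖) := by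
    rw [integrable_fun_norm_addHaar volume (f := h)]
    simp only [finrank_euclideanSpace, Fintype.card_fin, smul_eq_mul]
    rw [← Set.Ioc_union_Ioi_eq_Ioi (zero_le_one' ℝ)]
    refine IntegrableOn.union ?_ ?_
    · have : IntegrableOn (fun t : ℝ => L ^ 2 * t ^ (1 - 2 * σ)) (Set.Ioc 0 1) := by
        have := (intervalIntegral.intervalIntegrable_rpow' (a := 0) (b := 1)
          (show -1 < 1 - 2 * σ by linarith))
        rw [intervalIntegrable_iff_integrableOn_Ioc_of_le zero_le_one] at this
        exact this.const_mul _
      refine (integrableOn_congr_fun ?_ measurableSet_Ioc).1 this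
      intro t ht
      have ht0 : 0 < t := ht.1
      simp only [hh, ht.2, if_true]
      have e : t ^ ((n:ℝ) + 2 * σ) * t ^ (1 - 2 * σ) = t ^ (n - 1) * t * t := by
        rw [hpow t ht0, ← Real.rpow_add ht0]
        nth_rw 3 [← Real.rpow_one t]
        rw [← Real.rpow_add ht0]; congr 1; ring
      have hne : t ^ ((n:ℝ) + 2 * σ) ≠ 0 := (Real.rpow_pos_of_pos ht0 _).ne'
      field_simp
      linear_combination L ^ 2 * e
    · have : IntegrableOn (fun t : ℝ => (2 * B) ^ 2 * t ^ (-1 - 2 * σ)) (Set.Ioi 1) :=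
        (integrableOn_Ioi_rpow_of_lt (show -1 - 2 * σ < -1 by linarith) one_pos).const_mul _
      refine (integrableOn_congr_fun ?_ measurableSet_Ioi).1 this
      intro t ht
      have ht1 : 1 < t := ht
      have ht0 : 0 < t := by linarith
      simp only [hh, not_le.2 ht1, if_false]
      have e : t ^ ((n:ℝ) + 2 * σ) * t ^ (-1 - 2 * σ) = t ^ (n - 1) := by
        have := hpow t ht0
        have h2 : t ^ ((n:ℝ) + 2 * σ) * t ^ (-1 - 2 * σ) * t = t ^ (n:ℝ) := by
          nth_rw 3 [← Real.rpow_one t]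
          rw [← Real.rpow_add ht0, ← Real.rpow_add ht0]; congr 1; ring
        rw [← this] at h2
        exact mul_right_cancel₀ ht0.ne' h2
      have hne : t ^ ((n:ℝ) + 2 * σ) ≠ 0 := (Real.rpow_pos_of_pos ht0 _).ne'
      field_simp
      linear_combination B ^ 2 * e
  refine (key.comp_sub_left x).mono' ?_ (Filter.Eventually.of_forall fun y => ?_)
  · refine Measurable.aestronglyMeasurable ?_
    have := hv.measurable
    fun_prop
  · have hden : 0 ≤ ‖x - y‖ ^ ((n : ℝ) + 2 * σ) := Real.rpow_nonneg (norm_nonneg _) _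
    rw [Real.norm_of_nonneg (by positivity)]
    simp only [hh]
    split_ifs
    · rw [← mul_div_assoc, ← mul_pow]
      gcongr
      exact hL x y
    · gcongr
      calc ‖v x - v y‖ ≤ ‖v x‖ + ‖v y‖ := norm_sub_le _ _
        _ ≤ 2 * B := by linarith [hB x, hB y]

set_option maxHeartbeats 1000000 in
/-- pointwise estimate -/
lemma frac_pointwise {n : ℕ} (hn : 0 < n) (σ m : ℝ) (hσ : 0 < σ) (hm : 0 < m)
    (hmσ : 2 + m * (2 * σ / n) = m) :
    ∃ C > 0, ∀ v : EuclideanSpace ℝ (Fin n) → EuclideanSpace ℝ (Fin n), Continuous v →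
      HasCompactSupport v →
      (∀ x, Integrable (fun y => ‖v x - v y‖ ^ 2 / ‖x - y‖ ^ ((n : ℝ) + 2 * σ))) →
      ∀ x, ‖v x‖ ^ m ≤ C * (∫ y, ‖v y‖ ^ m) ^ (2 * σ / n) *
        ∫ y, ‖v x - v y‖ ^ 2 / ‖x - y‖ ^ ((n : ℝ) + 2 * σ) := by
  have : Nontrivial (EuclideanSpace ℝ (Fin n)) := by
    have : Nonempty (Fin n) := ⟨⟨0, hn⟩⟩
    infer_instance
  set ω : ℝ := volume.real (Metric.ball (0 : EuclideanSpace ℝ (Fin n)) 1) with hω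
  clear_value ω
  have hωpos : 0 < ω := by
    rw [hω, measureReal_def]
    exact ENNReal.toReal_pos (Metric.measure_ball_pos _ _ one_pos).ne' measure_ball_lt_top.ne
  set β : ℝ := 2 * σ / n with hβ
  clear_value β
  have hn' : (0:ℝ) < n := by exact_mod_cast hn
  have hβ0 : 0 < β := by rw [hβ]; positivity
  refine ⟨4 * (2 / ω) ^ (1 + β) * 2 ^ (m * β), by positivity, ?_⟩
  intro v hv hvc hint x
  have hFnn : ∀ y, 0 ≤ ‖v x - v y‖ ^ 2 / ‖x - y‖ ^ ((n : ℝ) + 2 * σ) := fun y => by positivity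
  have hDnn : 0 ≤ ∫ y, ‖v x - v y‖ ^ 2 / ‖x - y‖ ^ ((n : ℝ) + 2 * σ) :=
    integral_nonneg hFnn
  have hMnn : 0 ≤ ∫ y, ‖v y‖ ^ m := integral_nonneg fun y => by positivity
  rcases (norm_nonneg (v x)).eq_or_lt with h | ha
  · rw [← h, Real.zero_rpow hm.ne']
    refine mul_nonneg (mul_nonneg ?_ (Real.rpow_nonneg hMnn _)) hDnn
    clear hDnn hMnn hFnn h hint
    positivity
  have hcont : Continuous fun y => ‖v y‖ ^ m := hv.norm.rpow_const fun _ => Or.inr hm.le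
  have hcs : HasCompactSupport fun y => ‖v y‖ ^ m :=
    hvc.comp_left (g := fun z => ‖z‖ ^ m) (by simp [Real.zero_rpow hm.ne'])
  have hMi : Integrable fun y => ‖v y‖ ^ m := hcont.integrable_of_hasCompactSupport hcs
  have hM : 0 < ∫ y, ‖v y‖ ^ m :=
    hcont.integral_pos_of_hasCompactSupport_nonneg_nonzero hcs (fun y => by positivity)
      (x := x) (by positivity)
  set M := ∫ y, ‖v y‖ ^ m with hMdef
  clear_value M
  set a := ‖v x‖ with hadef
  clear_value a
  set K : ℝ := (2 / a) ^ m * M with hK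
  clear_value K
  have hKpos : 0 < K := by rw [hK]; positivity
  set A : Set (EuclideanSpace ℝ (Fin n)) := {y | (a / 2) ^ m ≤ ‖v y‖ ^ m} with hA
  have hAK : volume.real A ≤ K := by
    have := mul_meas_ge_le_integral_of_nonneg (μ := volume)
      (Filter.Eventually.of_forall fun y => (by positivity : (0:ℝ) ≤ ‖v y‖ ^ m)) hMi ((a / 2) ^ m)
    have e : (2 / a) ^ m * (a / 2) ^ m = 1 := by
      rw [← Real.mul_rpow (by positivity) (by positivity)]
      field_simp
      simp
    calc volume.real A = (2 / a) ^ m * ((a / 2) ^ m * volume.real A) := by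
          rw [← mul_assoc, e, one_mul]
      _ ≤ K := by rw [hK, hMdef]; gcongr
  have hAm : MeasurableSet A := measurableSet_le measurable_const hcont.measurable
  set r : ℝ := (2 * K / ω) ^ (1 / (n:ℝ)) with hr
  clear_value r
  have hrpos : 0 < r := by rw [hr]; positivity
  have hball : volume.real (Metric.ball x r) = 2 * K := by
    have : volume.real (Metric.ball x r) = r ^ n * ω := by
      rw [measureReal_def, Measure.addHaar_ball _ _ hrpos.le, ENNReal.toReal_mul,
        ENNReal.toReal_ofReal (by positivity), finrank_euclideanSpace, Fintype.card_fin, hω,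
        measureReal_def]
    rw [this, hr, ← Real.rpow_natCast, ← Real.rpow_mul (by positivity)]
    rw [one_div_mul_cancel hn'.ne', Real.rpow_one]
    field_simp
  set S := Metric.ball x r \ A with hS
  have hSm : MeasurableSet S := measurableSet_ball.diff hAm
  have hSfin : volume S ≠ ⊤ := ((measure_mono Set.sdiff_subset).trans_lt measure_ball_lt_top).ne
  have hSK : K ≤ volume.real S := by
    have h1 : volume.real (Metric.ball x r) ≤ volume.real S + volume.real (Metric.ball x r ∩ A) := by
      rw [hS, measureReal_sdiff_add_inter hAm measure_ball_lt_top.ne]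
    have hAfin : volume A ≠ ⊤ := by
      refine (hMi.measure_ge_lt_top (ε := (a / 2) ^ m) (by positivity)).ne
    have h2 : volume.real (Metric.ball x r ∩ A) ≤ volume.real A :=
      measureReal_mono Set.inter_subset_right hAfin
    linarith
  have hrpow : r ^ ((n:ℝ) + 2 * σ) = (2 * K / ω) ^ (1 + β) := by
    rw [hr, ← Real.rpow_mul (by positivity)]
    congr 1
    rw [hβ]; field_simp
  have hD : K * ((a / 2) ^ 2 / r ^ ((n : ℝ) + 2 * σ)) ≤
      ∫ y, ‖v x - v y‖ ^ 2 / ‖x - y‖ ^ ((n : ℝ) + 2 * σ) := by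
    calc K * ((a / 2) ^ 2 / r ^ ((n : ℝ) + 2 * σ))
        ≤ volume.real S * ((a / 2) ^ 2 / r ^ ((n : ℝ) + 2 * σ)) := by gcongr
      _ = ∫ y in S, ((a / 2) ^ 2 / r ^ ((n : ℝ) + 2 * σ)) := by simp
      _ ≤ ∫ y in S, ‖v x - v y‖ ^ 2 / ‖x - y‖ ^ ((n : ℝ) + 2 * σ) := by
          refine setIntegral_mono_on (integrableOn_const hSfin) (hint x).integrableOn hSm ?_
          rintro y ⟨hy1, hy2⟩
          have hvy : ‖v y‖ < a / 2 := by
            by_contra hcon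
            exact hy2 (Real.rpow_le_rpow (by positivity) (not_lt.1 hcon) hm.le)
          have h1 : a / 2 ≤ ‖v x - v y‖ := by
            have := norm_sub_norm_le (v x) (v y)
            linarith
          have hxy : x ≠ y := by
            rintro rfl
            linarith
          have h2 : 0 < ‖x - y‖ := norm_pos_iff.2 (sub_ne_zero.2 hxy)
          have h3 : ‖x - y‖ ≤ r := by
            rw [Metric.mem_ball, dist_comm, dist_eq_norm] at hy1
            exact hy1.le
          gcongr
      _ ≤ _ := setIntegral_le_integral (hint x) (Filter.Eventually.of_forall hFnn)
  rw [hrpow] at hD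
  set D := ∫ y, ‖v x - v y‖ ^ 2 / ‖x - y‖ ^ ((n : ℝ) + 2 * σ)
  clear_value D
  have eK : K ^ β * a ^ (m * β) = 2 ^ (m * β) * M ^ β := by
    rw [hK, Real.mul_rpow (by positivity) hM.le, ← Real.rpow_mul (by positivity),
      Real.div_rpow (by positivity) ha.le]
    field_simp
  have e1 : (2 * K / ω) ^ (1 + β) = (2 / ω) ^ (1 + β) * (K * K ^ β) := by
    rw [show 2 * K / ω = (2 / ω) * K by ring, Real.mul_rpow (by positivity) hKpos.le,
      Real.rpow_add hKpos, Real.rpow_one]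
  have e2 : a ^ m = a ^ 2 * a ^ (m * β) := by
    nth_rw 1 [← hmσ]
    rw [Real.rpow_add ha]; norm_cast
  rw [e1] at hD
  have hc : 0 < (2 / ω) ^ (1 + β) := by positivity
  set c := (2 / ω) ^ (1 + β)
  clear_value c
  have hD2 : a ^ 2 ≤ 4 * c * K ^ β * D := by
    have : K * ((a / 2) ^ 2 / (c * (K * K ^ β))) = a ^ 2 / (4 * c * K ^ β) := by
      field_simp; norm_num
    rw [this, div_le_iff₀ (by positivity)] at hD
    linarith
  calc a ^ m = a ^ 2 * a ^ (m * β) := e2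
    _ ≤ (4 * c * K ^ β * D) * a ^ (m * β) := by gcongr
    _ = 4 * c * (K ^ β * a ^ (m * β)) * D := by ring
    _ = _ := by rw [eK]; ring

/-- fractional Sobolev -/
lemma frac_sobolev {n : ℕ} (hn : 0 < n) (σ m : ℝ) (hσ : 0 < σ) (hm : 0 < m)
    (hmσ : 2 + m * (2 * σ / n) = m) :
    ∃ C > 0, ∀ v : EuclideanSpace ℝ (Fin n) → EuclideanSpace ℝ (Fin n), Continuous v →
      HasCompactSupport v →
      (∀ x, Integrable (fun y => ‖v x - v y‖ ^ 2 / ‖x - y‖ ^ ((n : ℝ) + 2 * σ))) →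
      Integrable (fun x => ∫ y, ‖v x - v y‖ ^ 2 / ‖x - y‖ ^ ((n : ℝ) + 2 * σ)) →
      (∫ y, ‖v y‖ ^ m) ^ (2 / m) ≤ C *
        ∫ x, ∫ y, ‖v x - v y‖ ^ 2 / ‖x - y‖ ^ ((n : ℝ) + 2 * σ) := by
  obtain ⟨C, hC, H⟩ := frac_pointwise hn σ m hσ hm hmσ
  refine ⟨C, hC, fun v hv hvc hint hint2 => ?_⟩
  have hcont : Continuous fun y => ‖v y‖ ^ m := hv.norm.rpow_const fun _ => Or.inr hm.le
  have hcs : HasCompactSupport fun y => ‖v y‖ ^ m :=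
    hvc.comp_left (g := fun z => ‖z‖ ^ m) (by simp [Real.zero_rpow hm.ne'])
  have hMi : Integrable fun y => ‖v y‖ ^ m := hcont.integrable_of_hasCompactSupport hcs
  have hMnn : 0 ≤ ∫ y, ‖v y‖ ^ m := integral_nonneg fun y => by positivity
  have hI : 0 ≤ ∫ x, ∫ y, ‖v x - v y‖ ^ 2 / ‖x - y‖ ^ ((n : ℝ) + 2 * σ) :=
    integral_nonneg fun x => integral_nonneg fun y => by positivity
  have h1 := integral_mono hMi (hint2.const_mul (C * (∫ y, ‖v y‖ ^ m) ^ (2 * σ / n)))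
    (fun x => H v hv hvc hint x)
  rw [integral_const_mul] at h1
  rcases hMnn.eq_or_lt with h | hM
  · rw [← h, Real.zero_rpow (by positivity)]; positivity
  set M := ∫ y, ‖v y‖ ^ m
  have e : M = M ^ (2 / m) * M ^ (2 * σ / n) := by
    rw [← Real.rpow_add hM]
    have : 2 / m + 2 * σ / n = 1 := by
      generalize 2 * σ / (n:ℝ) = b at hmσ
      field_simp
      linarith
    rw [this, Real.rpow_one]
  have hp : 0 < M ^ (2 * σ / n) := by positivity
  refine le_of_mul_le_mul_right ?_ hp
  rw [← e]
  linarith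

set_option maxHeartbeats 1000000 in
/-- the embedding used for all three exponents -/
lemma frac_embedding {n : ℕ} (hn : 0 < n) (σ : ℝ) (hσ : σ ∈ Set.Ioo (0:ℝ) 1)
    (hns : 2 * (1 + σ) < n) (Ω : Set (EuclideanSpace ℝ (Fin n)))
    (hΩbdd : Bornology.IsBounded Ω) (r : ℝ) (hr0 : 0 < r)
    (hr : r ≤ 2 * n / (n - 2 * (1 + σ))) :
    ∃ C > 0, ∀ ρ > 0, ∀ u : EuclideanSpace ℝ (Fin n) → ℝ,
        ContDiff ℝ (⊤ : ℕ∞) u → HasCompactSupport u → tsupport u ⊆ Ω →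
        Real.sqrt (∫ x, ∫ y, ‖gradient u x - gradient u y‖ ^ 2 / ‖x - y‖ ^ ((n : ℝ) + 2 * σ)) = ρ →
        ∫ x in Ω, |u x| ^ r ≤ C * ρ ^ r := by
  have hσ0 := hσ.1
  have hn' : (0:ℝ) < n := by exact_mod_cast hn
  have hd : 0 < (n:ℝ) - 2 * σ := by linarith
  have hd2 : 0 < (n:ℝ) - 2 * (1 + σ) := by linarith
  obtain ⟨m, hmdef⟩ : ∃ m : ℝ, m = 2 * n / (n - 2 * σ) := ⟨_, rfl⟩
  have hm0 : 0 < m := by rw [hmdef]; positivity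
  have hm1 : 1 ≤ m := by rw [hmdef, le_div_iff₀ hd]; linarith
  have hmn : m < n := by rw [hmdef, div_lt_iff₀ hd]; nlinarith
  have hmσ : 2 + m * (2 * σ / n) = m := by
    rw [hmdef]; field_simp; ring
  have hpq : m⁻¹ - (n:ℝ)⁻¹ ≤ r⁻¹ := by
    have : (2 * n / (n - 2 * (1 + σ)))⁻¹ ≤ r⁻¹ := inv_anti₀ hr0 hr
    refine le_trans (le_of_eq ?_) this
    rw [hmdef]; field_simp; ring
  obtain ⟨C, hC, H⟩ := frac_sobolev hn σ m hσ0 hm0 hmσ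
  obtain ⟨C', hC'⟩ : ∃ C' : NNReal, C' = eLpNormLESNormFDerivOfLeConst ℝ
    (volume : Measure (EuclideanSpace ℝ (Fin n))) Ω m.toNNReal r.toNNReal := ⟨_, rfl⟩
  refine ⟨((C':ℝ) * Real.sqrt C) ^ r + 1, by positivity, ?_⟩
  intro ρ hρ u hu huc hus hI
  have hI2 : (∫ x, ∫ y, ‖gradient u x - gradient u y‖ ^ 2 / ‖x - y‖ ^ ((n : ℝ) + 2 * σ)) = ρ ^ 2 := by
    rw [← hI, Real.sq_sqrt]
    exact integral_nonneg fun x => integral_nonneg fun y => by positivity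
  have hu1 : ContDiff ℝ 1 u := hu.of_le (by exact_mod_cast le_top)
  have hdu : ContDiff ℝ 1 (fderiv ℝ u) := hu.fderiv_right ((WithTop.coe_le_coe (b := (1 + 1 : ℕ∞)) (a := ⊤)).2 le_top)
  have hduc : HasCompactSupport (fderiv ℝ u) := huc.fderiv ℝ
  have hvn : ∀ x, ‖gradient u x‖ = ‖fderiv ℝ u x‖ := fun x => by simp [gradient]
  have hvs : ∀ x y, ‖gradient u x - gradient u y‖ = ‖fderiv ℝ u x - fderiv ℝ u y‖ := fun x y => by
    simp only [gradient, ← map_sub, LinearIsometryEquiv.norm_map]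
  have hvcont : Continuous (gradient u) :=
    (LinearIsometryEquiv.continuous _).comp hdu.continuous
  have hvc : HasCompactSupport (gradient u) := hduc.comp_left (map_zero _)
  obtain ⟨L, hL⟩ := hdu.lipschitzWith_of_hasCompactSupport hduc one_ne_zero
  obtain ⟨B, hB⟩ := hduc.exists_bound_of_continuous hdu.continuous
  have hint := frac_inner_integrable hn σ hσ (gradient u) hvcont L B
    (fun x y => by rw [hvs]; exact hL.norm_sub_le x y) (fun x => by rw [hvn]; exact hB x)
  have hint2 : Integrable (fun x => ∫ y, ‖gradient u x - gradient u y‖ ^ 2 /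
      ‖x - y‖ ^ ((n : ℝ) + 2 * σ)) := by
    by_contra hcon
    rw [integral_undef hcon] at hI2
    exact absurd hI2.symm (by positivity)
  have h1 := H (gradient u) hvcont hvc hint hint2
  rw [hI2] at h1
  simp only [hvn] at h1
  have hM : 0 ≤ ∫ y, ‖fderiv ℝ u y‖ ^ m := integral_nonneg fun y => by positivity
  have h2 : (∫ y, ‖fderiv ℝ u y‖ ^ m) ^ (m⁻¹) ≤ Real.sqrt C * ρ := by
    refine le_of_sq_le_sq ?_ (by positivity)
    rw [mul_pow, Real.sq_sqrt hC.le, ← Real.rpow_mul_natCast hM]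
    have e : m⁻¹ * ((2 : ℕ) : ℝ) = 2 / m := by push_cast; rw [div_eq_mul_inv, mul_comm]
    rw [e]
    exact h1
  have hGNS := eLpNorm_le_eLpNorm_fderiv_of_le
    (volume : Measure (EuclideanSpace ℝ (Fin n))) (F := ℝ) (u := u) (s := Ω) hu1
    ((subset_tsupport u).trans hus) (p := m.toNNReal) (q := r.toNNReal)
    (by rw [← NNReal.coe_le_coe, Real.coe_toNNReal _ hm0.le]; exact hm1)
    (by rw [← NNReal.coe_lt_coe, Real.coe_toNNReal _ hm0.le]; simpa using hmn)
    (by rw [NNReal.coe_inv, Real.coe_toNNReal _ hm0.le, Real.coe_toNNReal _ hr0.le]; simpa using hpq) hΩbdd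
  have hmE : (m.toNNReal : ENNReal) ≠ 0 := by simpa using hm0
  have hrE : (r.toNNReal : ENNReal) ≠ 0 := by simpa using hr0
  have hmu : MemLp u r.toNNReal := hu1.continuous.memLp_of_hasCompactSupport huc
  have hmd : MemLp (fderiv ℝ u) m.toNNReal := hdu.continuous.memLp_of_hasCompactSupport hduc
  rw [← hC', hmu.eLpNorm_eq_integral_rpow_norm hrE ENNReal.coe_ne_top,
    hmd.eLpNorm_eq_integral_rpow_norm hmE ENNReal.coe_ne_top] at hGNS
  simp only [ENNReal.coe_toReal, Real.coe_toNNReal _ hm0.le, Real.coe_toNNReal _ hr0.le] at hGNS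
  rw [← ENNReal.ofReal_coe_nnreal, ← ENNReal.ofReal_mul (by positivity),
    ENNReal.ofReal_le_ofReal_iff (by positivity)] at hGNS
  have hU : 0 ≤ ∫ y, ‖u y‖ ^ r := integral_nonneg fun y => by positivity
  have h3 : (∫ y, ‖u y‖ ^ r) ≤ ((C' * Real.sqrt C) * ρ) ^ r := by
    have h4 : (∫ y, ‖u y‖ ^ r) ^ r⁻¹ ≤ (C' * Real.sqrt C) * ρ := by
      rw [mul_assoc]; exact hGNS.trans (by gcongr)
    calc (∫ y, ‖u y‖ ^ r) = ((∫ y, ‖u y‖ ^ r) ^ r⁻¹) ^ r := by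
          rw [Real.rpow_inv_rpow hU hr0.ne']
      _ ≤ _ := Real.rpow_le_rpow (by positivity) h4 hr0.le
  have hui : Integrable fun y => ‖u y‖ ^ r :=
    (hu1.continuous.norm.rpow_const fun _ => Or.inr hr0.le).integrable_of_hasCompactSupport
      (huc.comp_left (g := fun z => ‖z‖ ^ r) (by simp [Real.zero_rpow hr0.ne']))
  calc ∫ x in Ω, |u x| ^ r ≤ ∫ x, ‖u x‖ ^ r :=
        setIntegral_le_integral hui (Filter.Eventually.of_forall fun y => by positivity)
    _ ≤ _ := h3
    _ = ((C' * Real.sqrt C)) ^ r * ρ ^ r := Real.mul_rpow (by positivity) hρ.le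
    _ ≤ _ := by gcongr; linarith

open MeasureTheory

/-- geometry for the concave-convex functional: there is `λ* > 0` such
that for `λ ∈ (0, λ*)` there exist `ρ, R > 0` with `J_λ(u) ≥ R` whenever `[u] = ρ`,
where `J_λ(u) = ½[u]² − (λ/p)∫_Ω|u|^p − ∫_Ω G(x,u)`. -/
theorem stmt_7 {n : ℕ} (hn : 0 < n) (σ : ℝ) (hσ : σ ∈ Set.Ioo (0:ℝ) 1)
    (hns : 2 * (1 + σ) < n) (Ω : Set (EuclideanSpace ℝ (Fin n)))
    (hΩne : Ω.Nonempty) (hΩopen : IsOpen Ω) (hΩbdd : Bornology.IsBounded Ω)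
    (p : ℝ) (hp : 1 < p) (hp2 : p < 2)
    (g : EuclideanSpace ℝ (Fin n) → ℝ → ℝ)
    (hg : Continuous fun z : EuclideanSpace ℝ (Fin n) × ℝ => g z.1 z.2)
    (a₁ a₂ : ℝ) (ha₁ : 0 < a₁) (ha₂ : 0 < a₂) (q : ℝ)
    (hq : q ∈ Set.Ioo 2 (2 * n / (n - 2 * (1 + σ))))
    (H1 : ∀ x ∈ Ω, ∀ t : ℝ, |g x t| ≤ a₁ + a₂ * |t| ^ (q - 1))
    (H2 : ∀ ε > 0, ∃ δ₀ > 0, ∀ x ∈ Ω, ∀ t : ℝ, |t| ≤ δ₀ → |g x t| ≤ ε * |t|) :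
    ∃ lamStar > 0, ∀ lam : ℝ, lam ∈ Set.Ioo 0 lamStar →
      ∃ ρ > 0, ∃ R > 0, ∀ u : EuclideanSpace ℝ (Fin n) → ℝ,
        ContDiff ℝ (⊤ : ℕ∞) u → HasCompactSupport u → tsupport u ⊆ Ω →
        Real.sqrt (∫ x, ∫ y, ‖gradient u x - gradient u y‖ ^ 2 / ‖x - y‖ ^ ((n : ℝ) + 2 * σ)) = ρ →
        R ≤ (1 / 2) *
              (∫ x, ∫ y, ‖gradient u x - gradient u y‖ ^ 2 / ‖x - y‖ ^ ((n : ℝ) + 2 * σ)) -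
            (lam / p) * (∫ x in Ω, |u x| ^ p) -
            ∫ x in Ω, (∫ τ in (0:ℝ)..(u x), g x τ) := by
  obtain ⟨hq2, hqc⟩ := hq
  obtain ⟨Cp, hCp, Hp⟩ := frac_embedding hn σ hσ hns Ω hΩbdd p (by linarith) (by linarith)
  obtain ⟨C2, hC2, Hs⟩ := frac_embedding hn σ hσ hns Ω hΩbdd 2 (by linarith) (by linarith)
  obtain ⟨Cq, hCq, Hq⟩ := frac_embedding hn σ hσ hns Ω hΩbdd q (by linarith) (by linarith)
  have hq0 : 0 < q := by linarith
  obtain ⟨ε, hε, hεC⟩ : ∃ ε > 0, ε * C2 = 1 / 4 := ⟨1 / (4 * C2), by positivity, by field_simp⟩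
  obtain ⟨δ, hδ, hgδ⟩ := H2 ε hε
  obtain ⟨c, hcpos, hc⟩ : ∃ c > 0, ∀ x ∈ Ω, ∀ t : ℝ, |g x t| ≤ ε * |t| + c * |t| ^ (q - 1) := by
    refine ⟨a₁ / δ ^ (q - 1) + a₂, by positivity, fun x hx t => ?_⟩
    rcases le_total |t| δ with h | h
    · have := hgδ x hx t h
      have h2 : 0 ≤ (a₁ / δ ^ (q - 1) + a₂) * |t| ^ (q - 1) := by positivity
      linarith
    · have h1 := H1 x hx t
      have h2 : δ ^ (q - 1) ≤ |t| ^ (q - 1) := Real.rpow_le_rpow hδ.le h (by linarith)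
      have h3 : a₁ ≤ a₁ / δ ^ (q - 1) * |t| ^ (q - 1) := by
        rw [div_mul_eq_mul_div, le_div_iff₀ (by positivity)]
        gcongr
      have h4 : 0 ≤ ε * |t| := by positivity
      linarith
  have hG : ∀ x ∈ Ω, ∀ t : ℝ, ‖∫ τ in (0:ℝ)..t, g x τ‖ ≤ ε * |t| ^ (2:ℝ) + c * |t| ^ q := by
    intro x hx t
    have h1 : ‖∫ τ in (0:ℝ)..t, g x τ‖ ≤ (ε * |t| + c * |t| ^ (q - 1)) * |t - 0| := by
      refine intervalIntegral.norm_integral_le_of_norm_le_const fun τ hτ => ?_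
      have hτt : |τ| ≤ |t| := by
        rcases le_total 0 t with h | h
        · rw [Set.uIoc_of_le h] at hτ
          rw [abs_of_nonneg h, abs_of_pos hτ.1]; exact hτ.2
        · rw [Set.uIoc_of_ge h] at hτ
          rw [abs_of_nonpos h, abs_of_nonpos hτ.2]; linarith [hτ.1]
      refine (hc x hx τ).trans ?_
      have : |τ| ^ (q - 1) ≤ |t| ^ (q - 1) := Real.rpow_le_rpow (abs_nonneg _) hτt (by linarith)
      gcongr
    refine h1.trans (le_of_eq ?_)
    have e : |t| ^ (q - 1) * |t| = |t| ^ q := by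
      nth_rw 2 [← Real.rpow_one |t|]
      rw [← Real.rpow_add_of_nonneg (abs_nonneg _) (by linarith) zero_le_one]
      congr 1; ring
    rw [sub_zero, Real.rpow_two, ← e]; ring
  -- choice of ρ
  obtain ⟨ρ, hρ, hρq⟩ : ∃ ρ > 0, c * Cq * ρ ^ (q - 2) = 1 / 8 := by
    refine ⟨(1 / (8 * (c * Cq))) ^ (1 / (q - 2)), by positivity, ?_⟩
    rw [← Real.rpow_mul (by positivity), one_div_mul_cancel (by linarith), Real.rpow_one]
    field_simp
  have hρq' : c * Cq * ρ ^ q = ρ ^ 2 / 8 := by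
    have : ρ ^ q = ρ ^ (q - 2) * ρ ^ 2 := by
      rw [← Real.rpow_two, ← Real.rpow_add hρ]; congr 1; ring
    rw [this, ← mul_assoc, hρq]; ring
  refine ⟨ρ ^ 2 / (16 * (Cp * ρ ^ p)), by positivity, fun lam hlam => ⟨ρ, hρ, ρ ^ 2 / 16,
    by positivity, ?_⟩⟩
  obtain ⟨hl0, hl1⟩ := hlam
  intro u hu huc hus hI
  have hup := Hp ρ hρ u hu huc hus hI
  have hu2 := Hs ρ hρ u hu huc hus hI
  have huq := Hq ρ hρ u hu huc hus hI
  have hI2 : (∫ x, ∫ y, ‖gradient u x - gradient u y‖ ^ 2 / ‖x - y‖ ^ ((n : ℝ) + 2 * σ)) = ρ ^ 2 := by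
    rw [← hI, Real.sq_sqrt]
    exact integral_nonneg fun x => integral_nonneg fun y => by positivity
  rw [hI2]
  have hui : ∀ r : ℝ, 0 < r → Integrable fun y => |u y| ^ r := fun r hr0 =>
    (hu.continuous.norm.rpow_const fun _ => Or.inr hr0.le).integrable_of_hasCompactSupport
      (huc.comp_left (g := fun z => ‖z‖ ^ r) (by simp [Real.zero_rpow hr0.ne']))
  have i2 := ((hui 2 two_pos).integrableOn (s := Ω)).const_mul ε
  have iq := ((hui q hq0).integrableOn (s := Ω)).const_mul c
  have hGi : ∫ x in Ω, (∫ τ in (0:ℝ)..(u x), g x τ) ≤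
      ε * (∫ x in Ω, |u x| ^ (2:ℝ)) + c * ∫ x in Ω, |u x| ^ q := by
    rw [← integral_const_mul, ← integral_const_mul, ← integral_add i2 iq]
    refine (Real.le_norm_self _).trans (norm_integral_le_of_norm_le (i2.add iq) ?_)
    exact (ae_restrict_iff' hΩopen.measurableSet).2
      (Filter.Eventually.of_forall fun x hx => hG x hx (u x))
  have b2 : ε * (∫ x in Ω, |u x| ^ (2:ℝ)) ≤ ρ ^ 2 / 4 := by
    rw [Real.rpow_two] at hu2
    calc _ ≤ ε * (C2 * ρ ^ 2) := by gcongr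
      _ = _ := by rw [← mul_assoc, hεC]; ring
  have bq : c * ∫ x in Ω, |u x| ^ q ≤ ρ ^ 2 / 8 := by
    calc _ ≤ c * (Cq * ρ ^ q) := by gcongr
      _ = _ := by rw [← mul_assoc, hρq']
  have bp : (lam / p) * (∫ x in Ω, |u x| ^ p) ≤ ρ ^ 2 / 16 := by
    have h1 : lam / p ≤ lam := div_le_self hl0.le hp.le
    have h2 : 0 ≤ ∫ x in Ω, |u x| ^ p := integral_nonneg fun x => by positivity
    rw [lt_div_iff₀ (by positivity)] at hl1
    calc _ ≤ lam * (Cp * ρ ^ p) := by gcongr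
      _ ≤ _ := by linarith
  linarith
end
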